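/- Let G be a finite group, S ⊆ G, and K ≤ G maximal such that S = KSK, and assume S ∩ K = ∅. Let M ≤ K and n = |M|. Then Cos(G,M,S) ≀ K̄_n ≅ (Cay(G,S)/(G/M)) ≀ K̄_n ≅ Cay(G,S), where G/M is the partition of G into left cosets of M. -/

import Mathlib

open scoped Pointwise

namespace DCG

/-- An isomorphism of digraphs: a bijection of vertex sets mapping arcs to arcs and
non-arcs to non-arcs. -/
structure Iso {V W : Type*} (Γ₁ : Digraph V) (Γ₂ : Digraph W) extends V ≃ W where
  adj_iff : ∀ u v : V, Γ₂.Adj (toEquiv u) (toEquiv v) ↔ Γ₁.Adj u v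

/-- The wreath product of two digraphs. -/
def wr {V₁ V₂ : Type*} (Γ₁ : Digraph V₁) (Γ₂ : Digraph V₂) : Digraph (V₁ × V₂) where
  Adj p q := Γ₁.Adj p.1 q.1 ∨ (p.1 = q.1 ∧ Γ₂.Adj p.2 q.2)

/-- The automorphism group of a digraph, as a subgroup of the symmetric group on the
vertices. -/
def Aut {V : Type*} (Γ : Digraph V) : Subgroup (Equiv.Perm V) where
  carrier := {e | ∀ u v : V, Γ.Adj (e u) (e v) ↔ Γ.Adj u v}
  one_mem' := by intro u v; rfl
  mul_mem' := by
    intro a b ha hb u v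
    simpa [Equiv.Perm.mul_apply] using ((ha (b u) (b v)).trans (hb u v))
  inv_mem' := by
    intro a ha u v
    simpa using (ha (a⁻¹ u) (a⁻¹ v)).symm

/-- A subgroup of the symmetric group is transitive. -/
def IsTransitiveSub {V : Type*} (A : Subgroup (Equiv.Perm V)) : Prop :=
  ∀ u v : V, ∃ g ∈ A, (g : Equiv.Perm V) u = v

/-- A digraph is vertex-transitive when its automorphism group is transitive. -/
def IsVertexTransitive {V : Type*} (Γ : Digraph V) : Prop :=
  IsTransitiveSub (Aut Γ)

/-- `ℬ` is a block system of the permutation group `A`: an `A`-invariant partition of the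
point set. -/
def IsBlockSystemOf {V : Type*} (A : Subgroup (Equiv.Perm V)) (ℬ : Set (Set V)) : Prop :=
  Setoid.IsPartition ℬ ∧ ∀ g ∈ A, ∀ B ∈ ℬ, (g : Equiv.Perm V) '' B ∈ ℬ

/-- The block quotient digraph of `Γ` with respect to a set `ℬ` of sets of vertices. -/
def quotDgr {V : Type*} (Γ : Digraph V) (ℬ : Set (Set V)) : Digraph ℬ where
  Adj B B' := B ≠ B' ∧ ∃ x ∈ (B : Set V), ∃ y ∈ (B' : Set V), Γ.Adj x y

/-- The subdigraph of `Γ` induced on a set `B` of vertices. -/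
def induce {V : Type*} (Γ : Digraph V) (B : Set V) : Digraph B where
  Adj x y := Γ.Adj (x : V) (y : V)

/-- The double coset digraph `Cos(G,H,S)`. -/
def cos (G : Type*) [Group G] (H : Subgroup G) (S : Set G) : Digraph (G ⧸ H) where
  Adj a b := ∃ g s : G, s ∈ S ∧ a = QuotientGroup.mk g ∧ b = QuotientGroup.mk (g * s)

/-- The Cayley digraph `Cay(G,S)`. -/
def cay (G : Type*) [Group G] (S : Set G) : Digraph G where
  Adj a b := ∃ s ∈ S, b = a * s

/-- The digraph on `n` vertices with no arcs. -/
def empt (n : ℕ) : Digraph (Fin n) where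
  Adj _ _ := False

/-- The wreath product of two permutation groups, in its imprimitive action. -/
def permWr {X Y : Type*} (A : Subgroup (Equiv.Perm X)) (B : Subgroup (Equiv.Perm Y)) :
    Subgroup (Equiv.Perm (X × Y)) where
  carrier := {e | ∃ g ∈ A, ∃ h : X → Equiv.Perm Y, (∀ x, h x ∈ B) ∧
    ∀ p : X × Y, e p = (g p.1, h p.1 p.2)}
  one_mem' := ⟨1, A.one_mem, fun _ => 1, fun _ => B.one_mem, fun _ => rfl⟩
  mul_mem' := by
    rintro a b ⟨g₁, hg₁, h₁, hh₁, he₁⟩ ⟨g₂, hg₂, h₂, hh₂, he₂⟩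
    refine ⟨g₁ * g₂, A.mul_mem hg₁ hg₂, fun x => h₁ (g₂ x) * h₂ x,
      fun x => B.mul_mem (hh₁ _) (hh₂ _), fun p => ?_⟩
    simp [Equiv.Perm.mul_apply, he₁, he₂]
  inv_mem' := by
    rintro a ⟨g, hg, h, hh, he⟩
    refine ⟨g⁻¹, A.inv_mem hg, fun x => (h (g⁻¹ x))⁻¹,
      fun x => B.inv_mem (hh _), fun p => ?_⟩
    have key : a (g⁻¹ p.1, (h (g⁻¹ p.1))⁻¹ p.2) = p := by
      rw [he]
      simp [Equiv.Perm.mul_apply]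
    calc a⁻¹ p = a⁻¹ (a (g⁻¹ p.1, (h (g⁻¹ p.1))⁻¹ p.2)) := by rw [key]
    _ = (g⁻¹ p.1, (h (g⁻¹ p.1))⁻¹ p.2) := by simp

/-- The induced action of a permutation group `A` on a system `ℬ` of sets of points,
as a subgroup of the symmetric group on `ℬ`. -/
def inducedOn {X : Type*} (A : Subgroup (Equiv.Perm X)) (ℬ : Set (Set X)) :
    Subgroup (Equiv.Perm ℬ) where
  carrier := {σ | ∃ g ∈ A, ∀ B : ℬ, ((σ B : Set X)) = (g : Equiv.Perm X) '' (B : Set X)}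
  one_mem' := ⟨1, A.one_mem, by simp⟩
  mul_mem' := by
    rintro a b ⟨g₁, hg₁, h₁⟩ ⟨g₂, hg₂, h₂⟩
    refine ⟨g₁ * g₂, A.mul_mem hg₁ hg₂, fun B => ?_⟩
    have : ((a * b) B : Set X) = (a (b B) : Set X) := rfl
    rw [this, h₁, h₂]
    ext x
    simp [Equiv.Perm.mul_apply, Set.image_image]
  inv_mem' := by
    rintro a ⟨g, hg, h⟩
    refine ⟨g⁻¹, A.inv_mem hg, fun B => ?_⟩
    have hb : ((a (a⁻¹ B)) : Set X) = (g : Equiv.Perm X) '' ((a⁻¹ B : ℬ) : Set X) := h _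
    have hab : a (a⁻¹ B) = B := by simp
    rw [hab] at hb
    rw [hb]
    ext x
    simp

/-- A digraph is complete if every ordered pair of distinct vertices is an arc. -/
def IsComplete {V : Type*} (Γ : Digraph V) : Prop := ∀ u v : V, u ≠ v → Γ.Adj u v

/-- A digraph has no arcs. -/
def HasNoArcs {V : Type*} (Γ : Digraph V) : Prop := ∀ u v : V, ¬ Γ.Adj u v

/-- A digraph is reducible if two distinct vertices have the same out-neighbours and the
same in-neighbours. -/
def Reducible {V : Type*} (Γ : Digraph V) : Prop :=
  ∃ u v : V, u ≠ v ∧ (∀ w, Γ.Adj u w ↔ Γ.Adj v w) ∧ (∀ w, Γ.Adj w u ↔ Γ.Adj w v)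

/-- A regular subgroup of a symmetric group: transitive, and only the identity fixes a
point. -/
def IsRegularSub {X : Type*} [Nonempty X] (L : Subgroup (Equiv.Perm X)) : Prop :=
  IsTransitiveSub L ∧ ∀ g ∈ L, (∃ x : X, (g : Equiv.Perm X) x = x) → g = 1

/-- A block system for a multiplicative action: an invariant partition. -/
def IsBlockSystemMul (G : Type*) [Group G] {X : Type*} [MulAction G X]
    (ℬ : Set (Set X)) : Prop :=
  Setoid.IsPartition ℬ ∧ ∀ (g : G), ∀ B ∈ ℬ, g • B ∈ ℬ

/-- `Γ` is isomorphic to a nontrivial wreath product of two vertex-transitive digraphs,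
each with at least two vertices. -/
def IsNontrivialWreathProduct {V : Type*} (Γ : Digraph V) : Prop :=
  ∃ (V₁ V₂ : Type) (Γ₁ : Digraph V₁) (Γ₂ : Digraph V₂),
    IsVertexTransitive Γ₁ ∧ IsVertexTransitive Γ₂ ∧
    2 ≤ Nat.card V₁ ∧ 2 ≤ Nat.card V₂ ∧ Nonempty (Iso Γ (wr Γ₁ Γ₂))

/-- The block quotient of a digraph on `G` by the partition of `G` into left cosets
of `H`, realized on the vertex set `G ⧸ H`. -/
def cosetQuot (G : Type*) [Group G] (H : Subgroup G) (Γ : Digraph G) : Digraph (G ⧸ H) where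
  Adj a b := a ≠ b ∧ ∃ x y : G, (QuotientGroup.mk x : G ⧸ H) = a ∧
    (QuotientGroup.mk y : G ⧸ H) = b ∧ Γ.Adj x y

theorem cay_adj_iff {G : Type*} [Group G] {S : Set G} {a b : G} :
    (cay G S).Adj a b ↔ a⁻¹ * b ∈ S := by
  constructor
  · rintro ⟨s, hs, rfl⟩
    simpa using hs
  · exact fun h => ⟨_, h, by simp⟩

section

variable {G : Type*} [Group G] {S : Set G} {K M : Subgroup G}

theorem mul_mul_mem_iff (hK : (K : Set G) * S * (K : Set G) = S) {k l g : G}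
    (hk : k ∈ K) (hl : l ∈ K) : k * g * l ∈ S ↔ g ∈ S := by
  have key : ∀ {k l g : G}, k ∈ K → l ∈ K → g ∈ S → k * g * l ∈ S := fun hk hl hg =>
    hK ▸ Set.mul_mem_mul (Set.mul_mem_mul hk hg) hl
  refine ⟨fun h => ?_, key hk hl⟩
  simpa [mul_assoc] using key (K.inv_mem hk) (K.inv_mem hl) h

theorem inv_mul_mem_iff_of_mk_eq (hK : (K : Set G) * S * (K : Set G) = S) (hM : M ≤ K)
    {a a' b b' : G} (ha : (a : G ⧸ M) = a') (hb : (b : G ⧸ M) = b') :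
    a⁻¹ * b ∈ S ↔ a'⁻¹ * b' ∈ S := by
  rw [QuotientGroup.eq] at ha hb
  rw [← mul_mul_mem_iff hK (g := a'⁻¹ * b') (hM ha) (K.inv_mem (hM hb))]
  simp [mul_assoc]

theorem cos_adj_mk_iff (hK : (K : Set G) * S * (K : Set G) = S) (hM : M ≤ K) (a b : G) :
    (cos G M S).Adj a b ↔ a⁻¹ * b ∈ S := by
  constructor
  · rintro ⟨g, s, hs, ha, hb⟩
    rw [inv_mul_mem_iff_of_mk_eq hK hM ha hb]
    simpa using hs
  · exact fun h => ⟨a, a⁻¹ * b, h, rfl, by simp⟩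

theorem cosetQuot_cay_adj_mk_iff (hK : (K : Set G) * S * (K : Set G) = S)
    (hdisj : S ∩ (K : Set G) = ∅) (hM : M ≤ K) (a b : G) :
    (cosetQuot G M (cay G S)).Adj a b ↔ a⁻¹ * b ∈ S := by
  constructor
  · rintro ⟨-, x, y, hx, hy, h⟩
    rwa [← inv_mul_mem_iff_of_mk_eq hK hM hx hy, ← cay_adj_iff]
  · refine fun h => ⟨fun hab => ?_, a, b, rfl, rfl, cay_adj_iff.2 h⟩
    exact Set.eq_empty_iff_forall_notMem.1 hdisj _ ⟨h, hM (QuotientGroup.eq.1 hab)⟩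

theorem cos_eq_cosetQuot_cay (hK : (K : Set G) * S * (K : Set G) = S)
    (hdisj : S ∩ (K : Set G) = ∅) (hM : M ≤ K) :
    cos G M S = cosetQuot G M (cay G S) := by
  ext x y
  induction x using QuotientGroup.induction_on with | _ a
  induction y using QuotientGroup.induction_on with | _ b
  rw [cos_adj_mk_iff hK hM, cosetQuot_cay_adj_mk_iff hK hdisj hM]

/-- The bijection `(gM, m) ↦ g'm`, where `g'` is the chosen representative of `gM`. -/
noncomputable def quotientProdEquiv (M : Subgroup G) : (G ⧸ M) × M ≃ G where
  toFun p := p.1.out * p.2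
  invFun g := (g, ⟨(g : G ⧸ M).out⁻¹ * g, QuotientGroup.eq.1 (QuotientGroup.out_eq' _)⟩)
  left_inv p := by
    have h : ((p.1.out * p.2 : G) : G ⧸ M) = p.1 := by simp
    ext <;> simp [h]
  right_inv g := by simp

theorem mk_quotientProdEquiv (p : (G ⧸ M) × M) :
    (quotientProdEquiv M p : G ⧸ M) = p.1 := by
  simp [quotientProdEquiv]

theorem nonempty_iso_wr_empt_cay [Finite M] (Γ : Digraph (G ⧸ M))
    (h : ∀ a b : G, Γ.Adj a b ↔ a⁻¹ * b ∈ S) :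
    Nonempty (Iso (wr Γ (empt (Nat.card M))) (cay G S)) := by
  let e : (G ⧸ M) × Fin (Nat.card M) ≃ G :=
    ((Equiv.refl _).prodCongr (Finite.equivFin M).symm).trans (quotientProdEquiv M)
  have he : ∀ p, (e p : G ⧸ M) = p.1 := fun p => mk_quotientProdEquiv _
  refine ⟨⟨e, fun u v => ?_⟩⟩
  rw [cay_adj_iff, ← h, he, he]
  simp [wr, empt]

end

/-- If `K ≤ G` is maximal with `S = KSK`, `S ∩ K = ∅`, `M ≤ K` and
`n = |M|`, then `Cos(G,M,S) ≀ K̄_n ≅ (Cay(G,S)/(G/M)) ≀ K̄_n ≅ Cay(G,S)`. -/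
theorem statement_13 {G : Type*} [Group G] [Finite G] (S : Set G) (K : Subgroup G)
    (hK : (K : Set G) * S * (K : Set G) = S)
    (hmax : ∀ L : Subgroup G, K < L → (L : Set G) * S * (L : Set G) ≠ S)
    (hdisj : S ∩ (K : Set G) = ∅) (M : Subgroup G) (hM : M ≤ K) :
    Nonempty (Iso (wr (cos G M S) (empt (Nat.card M))) (cay G S)) ∧
    Nonempty (Iso (wr (cosetQuot G M (cay G S)) (empt (Nat.card M))) (cay G S)) ∧
    Nonempty (Iso (wr (cos G M S) (empt (Nat.card M)))
      (wr (cosetQuot G M (cay G S)) (empt (Nat.card M)))) := by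
  have hcos := nonempty_iso_wr_empt_cay _ (cos_adj_mk_iff hK hM)
  have heq := cos_eq_cosetQuot_cay hK hdisj hM
  exact ⟨hcos, heq ▸ hcos, heq ▸ ⟨⟨Equiv.refl _, fun _ _ => Iff.rfl⟩⟩⟩

end DCG
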